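/- (Non-uniform disparity: calibration errors vanish as the entropy gap vanishes.) Let ℓ be a bounded proper scoring loss, Q* a PMF on X × Y with Q*_X(x) > 0 for all x ∈ X, h*(x) := Q*(·|x), and let (Q_n) be a sequence of PMFs on X × Y each satisfying R_{Q_n}(h*,ℓ) ≤ R_{Q*}(h*,ℓ). If B_{Q_n}(ℓ) → B_{Q*}(ℓ) as n → ∞, then CE_{Q_n}(h*,ℓ) → 0. -/

import Mathlib

open Finset
open scoped Classical

noncomputable section

/-- The standard probability simplex over a finite type `Y`. -/
def simplex (Y : Type*) [Fintype Y] : Set (Y → ℝ) :=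
  {p | (∀ y, 0 ≤ p y) ∧ ∑ y, p y = 1}

variable {X Y : Type*}

/-- Expected loss `L(p,q) = Σ_y p(y)·ℓ(y,q)`. -/
def expLoss [Fintype Y] (ℓ : Y → (Y → ℝ) → ℝ) (p q : Y → ℝ) : ℝ :=
  ∑ y, p y * ℓ y q

/-- A scoring loss is bounded by `M` if `0 ≤ ℓ(y,q) ≤ M` for all `y` and `q ∈ Δ^Y`. -/
def IsBoundedLoss [Fintype Y] (ℓ : Y → (Y → ℝ) → ℝ) (M : ℝ) : Prop :=
  ∀ y : Y, ∀ q ∈ simplex Y, 0 ≤ ℓ y q ∧ ℓ y q ≤ M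

/-- A scoring loss is proper if `L(p,p) ≤ L(p,q)` for all `p, q ∈ Δ^Y`. -/
def IsProper [Fintype Y] (ℓ : Y → (Y → ℝ) → ℝ) : Prop :=
  ∀ p ∈ simplex Y, ∀ q ∈ simplex Y, expLoss ℓ p p ≤ expLoss ℓ p q

/-- Generalized entropy `H_ℓ(p) = inf_{q ∈ Δ^Y} L(p,q)`. -/
def genEnt [Fintype Y] (ℓ : Y → (Y → ℝ) → ℝ) (p : Y → ℝ) : ℝ :=
  sInf ((fun q => expLoss ℓ p q) '' simplex Y)

/-- Bregman divergence `d_ℓ(p,q) = L(p,q) − H_ℓ(p)`. -/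
def breg [Fintype Y] (ℓ : Y → (Y → ℝ) → ℝ) (p q : Y → ℝ) : ℝ :=
  expLoss ℓ p q - genEnt ℓ p

/-- A probability mass function on `X × Y`. -/
def IsPMF [Fintype X] [Fintype Y] (P : X × Y → ℝ) : Prop :=
  (∀ z, 0 ≤ P z) ∧ ∑ z, P z = 1

/-- The `X`-marginal `P_X(x) = Σ_y P(x,y)`. -/
def margX [Fintype Y] (P : X × Y → ℝ) (x : X) : ℝ := ∑ y, P (x, y)

/-- The conditional distribution `P(·|x)`. -/
def condY [Fintype Y] (P : X × Y → ℝ) (x : X) : Y → ℝ :=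
  fun y => P (x, y) / margX P x

/-- Risk `R_P(h,ℓ) = Σ_{x,y} P(x,y)·ℓ(y,h(x))`. -/
def risk [Fintype X] [Fintype Y] (P : X × Y → ℝ) (h : X → Y → ℝ)
    (ℓ : Y → (Y → ℝ) → ℝ) : ℝ :=
  ∑ z : X × Y, P z * ℓ z.2 (h z.1)

/-- The weight `w_ν = Σ_{x : h(x)=ν} P_X(x)`. -/
def weight [Fintype X] [Fintype Y] (P : X × Y → ℝ) (h : X → Y → ℝ) (ν : Y → ℝ) : ℝ :=
  ∑ x ∈ univ.filter (fun x => h x = ν), margX P x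

/-- The conditional outcome distribution `P(·|h=ν)`. -/
def condOut [Fintype X] [Fintype Y] (P : X × Y → ℝ) (h : X → Y → ℝ) (ν : Y → ℝ) : Y → ℝ :=
  fun y => (∑ x ∈ univ.filter (fun x => h x = ν), P (x, y)) / weight P h ν

/-- `h` is canonically calibrated under `P` if `P(·|h=ν) = ν` whenever `w_ν > 0`. -/
def Calibrated [Fintype X] [Fintype Y] (P : X × Y → ℝ) (h : X → Y → ℝ) : Prop :=
  ∀ ν : Y → ℝ, 0 < weight P h ν → condOut P h ν = ν

/-- Calibration error `CE_P(h,ℓ) = Σ_{ν : w_ν>0} w_ν · d_ℓ(P(·|h=ν), ν)`,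
the sum ranging over the (finitely many) values in the range of `h`. -/
def CE [Fintype X] [Fintype Y] (P : X × Y → ℝ) (h : X → Y → ℝ)
    (ℓ : Y → (Y → ℝ) → ℝ) : ℝ :=
  ∑ ν ∈ (univ.image h).filter (fun ν => 0 < weight P h ν),
    weight P h ν * breg ℓ (condOut P h ν) ν

/-- Refinement `RF_P(h,ℓ) = Σ_{ν : w_ν>0} w_ν · H_ℓ(P(·|h=ν))`. -/
def RF [Fintype X] [Fintype Y] (P : X × Y → ℝ) (h : X → Y → ℝ)
    (ℓ : Y → (Y → ℝ) → ℝ) : ℝ :=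
  ∑ ν ∈ (univ.image h).filter (fun ν => 0 < weight P h ν),
    weight P h ν * genEnt ℓ (condOut P h ν)

/-- Bayes refinement `B_P(ℓ) = Σ_{x : P_X(x)>0} P_X(x) · H_ℓ(P(·|x))`. -/
def BayesRF [Fintype X] [Fintype Y] (P : X × Y → ℝ) (ℓ : Y → (Y → ℝ) → ℝ) : ℝ :=
  ∑ x ∈ univ.filter (fun x => 0 < margX P x), margX P x * genEnt ℓ (condY P x)

/-- The optimal (Bayes) value `V(Q) = inf_{h : X → Δ^Y} R_Q(h,ℓ)`. -/
def mdlV [Fintype X] [Fintype Y] (ℓ : Y → (Y → ℝ) → ℝ) (Q : X × Y → ℝ) : ℝ :=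
  sInf {r : ℝ | ∃ h : X → Y → ℝ, (∀ x, h x ∈ simplex Y) ∧ r = risk Q h ℓ}

section ScoringLoss

variable [Fintype Y] {ℓ : Y → (Y → ℝ) → ℝ} {M : ℝ}

lemma genEnt_le_expLoss (hb : IsBoundedLoss ℓ M) {p q : Y → ℝ} (hp : ∀ y, 0 ≤ p y)
    (hq : q ∈ simplex Y) : genEnt ℓ p ≤ expLoss ℓ p q := by
  refine csInf_le ⟨0, ?_⟩ ⟨q, hq, rfl⟩
  rintro _ ⟨r, hr, rfl⟩
  exact Finset.sum_nonneg fun y _ => mul_nonneg (hp y) (hb y r hr).1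

lemma le_genEnt {p : Y → ℝ} {c : ℝ} (hne : (simplex Y).Nonempty)
    (h : ∀ q ∈ simplex Y, c ≤ expLoss ℓ p q) : c ≤ genEnt ℓ p := by
  refine le_csInf (hne.image _) ?_
  rintro _ ⟨q, hq, rfl⟩
  exact h q hq

lemma mul_expLoss_div {a : Y → ℝ} {w : ℝ} (hw : 0 < w) (q : Y → ℝ) :
    w * expLoss ℓ (fun y => a y / w) q = expLoss ℓ a q := by
  simp only [expLoss, Finset.mul_sum]
  refine Finset.sum_congr rfl fun y _ => ?_
  field_simp

end ScoringLoss

section Risk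

variable [Fintype Y] {ℓ : Y → (Y → ℝ) → ℝ} {M : ℝ} {P : X × Y → ℝ} {h : X → Y → ℝ}

lemma margX_nonneg (hP : ∀ z, 0 ≤ P z) (x : X) : 0 ≤ margX P x :=
  Finset.sum_nonneg fun _ _ => hP _

lemma condY_mem_simplex (hP : ∀ z, 0 ≤ P z) {x : X} (hx : 0 < margX P x) :
    condY P x ∈ simplex Y := by
  refine ⟨fun y => div_nonneg (hP _) hx.le, ?_⟩
  simp only [condY, ← Finset.sum_div]
  exact div_self hx.ne'

lemma margX_mul_genEnt_le (hb : IsBoundedLoss ℓ M) (hP : ∀ z, 0 ≤ P z) (x : X) {q : Y → ℝ}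
    (hq : q ∈ simplex Y) :
    margX P x * genEnt ℓ (condY P x) ≤ expLoss ℓ (fun y => P (x, y)) q := by
  rcases (margX_nonneg hP x).eq_or_lt with hx | hx
  · rw [← hx, zero_mul]
    exact Finset.sum_nonneg fun y _ => mul_nonneg (hP _) (hb y q hq).1
  · rw [← mul_expLoss_div (a := fun y => P (x, y)) hx q]
    exact mul_le_mul_of_nonneg_left
      (genEnt_le_expLoss hb (fun y => div_nonneg (hP _) hx.le) hq) hx.le

variable [Fintype X]

lemma risk_eq_sum_expLoss :
    risk P h ℓ = ∑ x, expLoss ℓ (fun y => P (x, y)) (h x) :=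
  Fintype.sum_prod_type _

lemma BayesRF_eq_sum (hP : ∀ z, 0 ≤ P z) :
    BayesRF P ℓ = ∑ x, margX P x * genEnt ℓ (condY P x) := by
  refine Finset.sum_subset (Finset.filter_subset _ _) fun x _ hx => ?_
  have hx0 : margX P x = 0 := by
    refine le_antisymm ?_ (margX_nonneg hP x)
    simpa using hx
  rw [hx0, zero_mul]

lemma weight_mul_expLoss_condOut {ν : Y → ℝ} (hw : 0 < weight P h ν) (q : Y → ℝ) :
    weight P h ν * expLoss ℓ (condOut P h ν) q
      = ∑ x ∈ univ.filter (fun x => h x = ν), expLoss ℓ (fun y => P (x, y)) q := by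
  unfold condOut
  rw [mul_expLoss_div hw]
  simp only [expLoss, Finset.sum_mul]
  exact Finset.sum_comm

lemma condOut_nonneg (hP : ∀ z, 0 ≤ P z) {ν : Y → ℝ} (hw : 0 < weight P h ν) (y : Y) :
    0 ≤ condOut P h ν y :=
  div_nonneg (Finset.sum_nonneg fun _ _ => hP _) hw.le

lemma CE_nonneg (hb : IsBoundedLoss ℓ M) (hP : ∀ z, 0 ≤ P z) (hh : ∀ x, h x ∈ simplex Y) :
    0 ≤ CE P h ℓ := by
  refine Finset.sum_nonneg fun ν hν => ?_
  obtain ⟨hν, hw⟩ := Finset.mem_filter.1 hν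
  obtain ⟨x, -, rfl⟩ := Finset.mem_image.1 hν
  exact mul_nonneg hw.le (sub_nonneg.2 (genEnt_le_expLoss hb (condOut_nonneg hP hw) (hh x)))

/-- The calibration error is at most the regret relative to the Bayes refinement. -/
lemma CE_le_risk_sub_BayesRF (hb : IsBoundedLoss ℓ M) (hP : ∀ z, 0 ≤ P z)
    (hh : ∀ x, h x ∈ simplex Y) : CE P h ℓ ≤ risk P h ℓ - BayesRF P ℓ := by
  have hgap : ∀ x, 0 ≤ expLoss ℓ (fun y => P (x, y)) (h x)
      - margX P x * genEnt ℓ (condY P x) :=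
    fun x => sub_nonneg.2 (margX_mul_genEnt_le hb hP x (hh x))
  rw [risk_eq_sum_expLoss, BayesRF_eq_sum hP, ← Finset.sum_sub_distrib,
    ← Finset.sum_fiberwise_of_maps_to
      (fun x _ => Finset.mem_image_of_mem h (Finset.mem_univ x))]
  refine (Finset.sum_le_sum fun ν hν => ?_).trans
    (Finset.sum_le_sum_of_subset_of_nonneg (Finset.filter_subset _ _)
      fun ν _ _ => Finset.sum_nonneg fun x _ => hgap x)
  obtain ⟨hν, hw⟩ := Finset.mem_filter.1 hν
  obtain ⟨x₀, -, -⟩ := Finset.mem_image.1 hν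
  have hent : ∑ x ∈ univ.filter (fun x => h x = ν), margX P x * genEnt ℓ (condY P x)
      ≤ weight P h ν * genEnt ℓ (condOut P h ν) := by
    rw [← div_le_iff₀' hw]
    refine le_genEnt ⟨h x₀, hh x₀⟩ fun q hq => ?_
    rw [div_le_iff₀' hw, weight_mul_expLoss_condOut hw]
    exact Finset.sum_le_sum fun x _ => margX_mul_genEnt_le hb hP x hq
  have hloss : weight P h ν * expLoss ℓ (condOut P h ν) ν
      = ∑ x ∈ univ.filter (fun x => h x = ν), expLoss ℓ (fun y => P (x, y)) (h x) := by
    rw [weight_mul_expLoss_condOut hw]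
    refine Finset.sum_congr rfl fun x hx => ?_
    rw [(Finset.mem_filter.1 hx).2]
  rw [Finset.sum_sub_distrib, breg, mul_sub, hloss]
  exact sub_le_sub_left hent _

/-- The Bayes predictor attains the Bayes refinement. -/
lemma risk_condY_le_BayesRF (hp : IsProper ℓ) (hP : ∀ z, 0 ≤ P z)
    (hpos : ∀ x, 0 < margX P x) : risk P (fun x => condY P x) ℓ ≤ BayesRF P ℓ := by
  rw [risk_eq_sum_expLoss, BayesRF_eq_sum hP]
  refine Finset.sum_le_sum fun x _ => ?_
  have hc := condY_mem_simplex hP (hpos x)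
  rw [← mul_expLoss_div (a := fun y => P (x, y)) (hpos x)]
  exact mul_le_mul_of_nonneg_left (le_genEnt ⟨_, hc⟩ (hp _ hc)) (hpos x).le

end Risk

/-- non-uniform disparity: if the expected-entropy gap vanishes,
`B_{Q_n}(ℓ) → B_{Q*}(ℓ)`, then the calibration errors vanish, `CE_{Q_n}(h*,ℓ) → 0`. -/
theorem calibration_error_vanishes
    [Fintype X] [Fintype Y] [Nonempty X] [Nonempty Y]
    (ℓ : Y → (Y → ℝ) → ℝ) (M : ℝ) (hb : IsBoundedLoss ℓ M) (hp : IsProper ℓ)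
    (Qs : X × Y → ℝ) (hQs : IsPMF Qs) (hpos : ∀ x, 0 < margX Qs x)
    (Qseq : ℕ → X × Y → ℝ) (hQn : ∀ n, IsPMF (Qseq n))
    (hsaddle : ∀ n,
      risk (Qseq n) (fun x => condY Qs x) ℓ ≤ risk Qs (fun x => condY Qs x) ℓ)
    (hconv : Filter.Tendsto (fun n => BayesRF (Qseq n) ℓ) Filter.atTop
      (nhds (BayesRF Qs ℓ))) :
    Filter.Tendsto (fun n => CE (Qseq n) (fun x => condY Qs x) ℓ) Filter.atTop
      (nhds 0) := by
  have hh : ∀ x, condY Qs x ∈ simplex Y := fun x => condY_mem_simplex hQs.1 (hpos x)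
  have hlim : Filter.Tendsto (fun n => BayesRF Qs ℓ - BayesRF (Qseq n) ℓ) Filter.atTop
      (nhds 0) := by
    simpa using hconv.const_sub (BayesRF Qs ℓ)
  refine squeeze_zero (fun n => CE_nonneg hb (hQn n).1 hh) (fun n => ?_) hlim
  exact (CE_le_risk_sub_BayesRF hb (hQn n).1 hh).trans
    (sub_le_sub_right ((hsaddle n).trans (risk_condY_le_BayesRF hp hQs.1 hpos)) _)

end
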